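/- For every m ∈ ℕ there exists a constant C > 0, depending only on p, s, γ, m, ρ and φ, such that for every real n ≥ 2, every t ∈ ℝ, every ε > 0 and every multi-index α ∈ ℕ³ with |α| = m, one has ‖∂^α v_nᵉ(t, ·)‖_{L^∞(ℝ³)} ≤ C κ_n n^{m+3/2−s} (1 + (|t| λ_n²)^m) · min(1, 1/(ε n))^{m+3/2}. -/

import Mathlib

open MeasureTheory Real ENNReal

noncomputable section

abbrev E3 := EuclideanSpace ℝ (Fin 3)

/-- Partial derivative in the `i`-th coordinate direction. -/
def pd {F : Type} [NormedAddCommGroup F] [NormedSpace ℝ F] (i : Fin 3) (f : E3 → F) : E3 → F :=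
  fun x => fderiv ℝ f x (EuclideanSpace.single i 1)

/-- Iterated partial derivative associated with the multi-index `α : Fin 3 → ℕ`. -/
def pda {F : Type} [NormedAddCommGroup F] [NormedSpace ℝ F] (α : Fin 3 → ℕ) (f : E3 → F) :
    E3 → F :=
  (pd 0)^[α 0] ((pd 1)^[α 1] ((pd 2)^[α 2] f))

/-- The approximate identity `ρ_ε`. -/
def rhoeps (ρ : E3 → ℝ) (ε : ℝ) : E3 → ℝ := fun x => (ε ^ 3)⁻¹ * ρ (ε⁻¹ • x)

def kap (γ n : ℝ) : ℝ := Real.log n ^ (-γ)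

def lam (p : ℕ) (s γ n : ℝ) : ℝ :=
  kap γ n ^ (((p : ℝ) - 1) / 2) * n ^ (((3 : ℝ) / 2 - s) * ((p : ℝ) - 1) / 2)

/-- The bubble `v_n(0,·)`. -/
def bubble (s γ : ℝ) (φ : E3 → ℝ) (n : ℝ) : E3 → ℝ :=
  fun x => kap γ n * n ^ ((3 : ℝ) / 2 - s) * φ (n • x)

/-- Convolution of two real valued functions on `ℝ³`. -/
def convR (f g : E3 → ℝ) : E3 → ℝ :=
  MeasureTheory.convolution f g (ContinuousLinearMap.lsmul ℝ ℝ) volume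

/-- The regularized bubble `v_nᵉ(0,·) = ρ_ε ∗ v_n(0,·)`. -/
def bubbleE (s γ : ℝ) (ρ φ : E3 → ℝ) (n ε : ℝ) : E3 → ℝ :=
  convR (rhoeps ρ ε) (bubble s γ φ n)

/-- The ODE profile `v_nᵉ(t,x) = v_nᵉ(0,x) exp(iσt |v_nᵉ(0,x)|^{p-1})`. -/
def vE (σ : ℝ) (p : ℕ) (s γ : ℝ) (ρ φ : E3 → ℝ) (n ε t : ℝ) : E3 → ℂ :=
  fun x => (bubbleE s γ ρ φ n ε x : ℂ) *
    Complex.exp (Complex.I * σ * t * ((|bubbleE s γ ρ φ n ε x| ^ ((p : ℝ) - 1) : ℝ) : ℂ))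

/-- All derivatives of `f` of order at most `m` obey `‖D^k f‖ ≤ B r^k`. -/
def DerivBound {E F : Type} [NormedAddCommGroup E] [NormedSpace ℝ E]
    [NormedAddCommGroup F] [NormedSpace ℝ F] (m : ℕ) (f : E → F) (B r : ℝ) : Prop :=
  ∀ k ≤ m, ∀ x, ‖iteratedFDeriv ℝ k f x‖ ≤ B * r ^ k

section DerivBound

variable {E F : Type} [NormedAddCommGroup E] [NormedSpace ℝ E]
  [NormedAddCommGroup F] [NormedSpace ℝ F]

theorem DerivBound.nonneg {m : ℕ} {f : E → F} {B r : ℝ} (h : DerivBound m f B r) : 0 ≤ B := by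
  simpa using (norm_nonneg _).trans (h 0 (Nat.zero_le m) 0)

theorem DerivBound.mono {m : ℕ} {f : E → F} {B B' r r' : ℝ} (h : DerivBound m f B r)
    (hB : B ≤ B') (hr0 : 0 ≤ r) (hr : r ≤ r') : DerivBound m f B' r' := fun k hk x =>
  (h k hk x).trans (mul_le_mul hB (pow_le_pow_left₀ hr0 hr k) (by positivity)
    (h.nonneg.trans hB))

theorem DerivBound.smul {m : ℕ} {f : E → ℝ} {g : E → F} {A B r : ℝ}
    (hf : ContDiff ℝ (⊤ : ℕ∞) f) (hg : ContDiff ℝ (⊤ : ℕ∞) g) (hr : 0 ≤ r)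
    (hfA : DerivBound m f A r) (hgB : DerivBound m g B r) :
    DerivBound m (fun x => f x • g x) (2 ^ m * A * B) r := by
  intro k hk x
  have hA := hfA.nonneg
  have hB := hgB.nonneg
  calc ‖iteratedFDeriv ℝ k (fun x => f x • g x) x‖
      ≤ ∑ i ∈ Finset.range (k + 1),
          (k.choose i : ℝ) * ‖iteratedFDeriv ℝ i f x‖ * ‖iteratedFDeriv ℝ (k - i) g x‖ :=
        norm_iteratedFDeriv_smul_le hf hg x (by exact_mod_cast le_top)
    _ ≤ ∑ i ∈ Finset.range (k + 1), (k.choose i : ℝ) * (A * B * r ^ k) := by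
        refine Finset.sum_le_sum fun i hi => ?_
        have hik : i ≤ k := Nat.lt_succ_iff.mp (Finset.mem_range.mp hi)
        have h1 := hfA i (hik.trans hk) x
        have h2 := hgB (k - i) ((Nat.sub_le k i).trans hk) x
        rw [mul_assoc]
        refine mul_le_mul_of_nonneg_left ?_ (by positivity)
        calc _ ≤ (A * r ^ i) * (B * r ^ (k - i)) :=
              mul_le_mul h1 h2 (norm_nonneg _) (by positivity)
          _ = A * B * (r ^ i * r ^ (k - i)) := by ring
          _ = A * B * r ^ k := by rw [← pow_add, Nat.add_sub_cancel' hik]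
    _ = 2 ^ k * (A * B * r ^ k) := by
        rw [← Finset.sum_mul]
        congr 1
        exact_mod_cast Nat.sum_range_choose k
    _ ≤ 2 ^ m * (A * B * r ^ k) := by
        have : (2 : ℝ) ^ k ≤ 2 ^ m := pow_le_pow_right₀ one_le_two hk
        gcongr
    _ = 2 ^ m * A * B * r ^ k := by ring

theorem DerivBound.pow_succ {m : ℕ} {f : E → ℝ} {A r : ℝ} (hf : ContDiff ℝ (⊤ : ℕ∞) f)
    (hr : 0 ≤ r) (hfA : DerivBound m f A r) (q : ℕ) :
    DerivBound m (fun x => f x ^ (q + 1)) ((2 ^ m) ^ q * A ^ (q + 1)) r := by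
  induction q with
  | zero => simpa using hfA
  | succ q ih =>
    have h := DerivBound.smul hf (hf.pow (q + 1)) hr hfA ih
    have h1 : (fun x => f x ^ (q + 1 + 1)) = fun x => f x • f x ^ (q + 1) :=
      funext fun x => by rw [smul_eq_mul]; ring
    rw [h1, show ((2 : ℝ) ^ m) ^ (q + 1) * A ^ (q + 1 + 1) =
      2 ^ m * A * ((2 ^ m) ^ q * A ^ (q + 1)) by ring]
    exact h

theorem DerivBound.const_mul {m : ℕ} {f : E → ℝ} {A r : ℝ} (hf : ContDiff ℝ (⊤ : ℕ∞) f)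
    (hfA : DerivBound m f A r) (c : ℝ) :
    DerivBound m (fun x => c * f x) (|c| * A) r := by
  intro k hk x
  have h : iteratedFDeriv ℝ k (fun x => c * f x) x = c • iteratedFDeriv ℝ k f x :=
    iteratedFDeriv_const_smul_apply' (a := c)
      ((hf.of_le (by exact_mod_cast le_top)).contDiffAt)
  rw [h, norm_smul, Real.norm_eq_abs, mul_assoc]
  exact mul_le_mul_of_nonneg_left (hfA k hk x) (abs_nonneg c)

theorem DerivBound.comp_const_smul {m : ℕ} {f : E → F} {A a : ℝ} (hf : ContDiff ℝ (⊤ : ℕ∞) f)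
    (hfA : DerivBound m f A 1) (ha : 0 ≤ a) :
    DerivBound m (fun x => f (a • x)) A a := by
  intro k hk x
  have h := congrFun (iteratedFDeriv_comp_const_smul (𝕜 := ℝ) (i := k) (f := f) a
    (hf.of_le (by exact_mod_cast le_top))) x
  rw [h, norm_smul, norm_pow, Real.norm_of_nonneg ha, mul_comm]
  gcongr
  simpa using hfA k hk (a • x)

theorem iteratedDeriv_cexp_I_mul (k : ℕ) :
    iteratedDeriv k (fun y : ℝ => Complex.exp (Complex.I * y)) =
      fun y : ℝ => Complex.I ^ k * Complex.exp (Complex.I * y) := by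
  induction k with
  | zero => simp
  | succ k ih =>
    rw [iteratedDeriv_succ, ih]
    ext y
    have h : HasDerivAt (fun y : ℝ => Complex.exp (Complex.I * y))
        (Complex.exp (Complex.I * y) * Complex.I) y := by
      simpa using ((Complex.ofRealCLM.hasDerivAt (x := y)).const_mul Complex.I).cexp
    rw [(h.const_mul (Complex.I ^ k)).deriv]
    ring

theorem DerivBound.cexp {m : ℕ} {f : E → ℝ} {A r : ℝ} (hf : ContDiff ℝ (⊤ : ℕ∞) f)
    (hr : 0 ≤ r) (hfA : DerivBound m f A r) :
    DerivBound m (fun x => Complex.exp (Complex.I * f x)) (m.factorial) ((1 + A) * r) := by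
  intro k hk x
  have hA := hfA.nonneg
  have hg : ContDiff ℝ (⊤ : ℕ∞) (fun y : ℝ => Complex.exp (Complex.I * y)) :=
    (contDiff_const.mul Complex.ofRealCLM.contDiff).cexp
  have h := norm_iteratedFDeriv_comp_le hg hf (n := k) (by exact_mod_cast le_top) x
    (C := 1) (D := (1 + A) * r)
    (fun i _ => by
      rw [norm_iteratedFDeriv_eq_norm_iteratedDeriv, iteratedDeriv_cexp_I_mul]
      simp [mul_comm Complex.I, Complex.norm_exp_ofReal_mul_I])
    (fun i hi hik => by
      refine (hfA i (hik.trans hk) x).trans ?_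
      rw [mul_pow]
      gcongr
      exact (by linarith : A ≤ 1 + A).trans (le_self_pow₀ (by linarith) (by omega)))
  refine h.trans ?_
  rw [mul_one]
  have : (k.factorial : ℝ) ≤ m.factorial := by exact_mod_cast Nat.factorial_le hk
  gcongr

/-- Derivative bounds for the nonlinear profile `f exp(iTf^{q+1})`. -/
theorem DerivBound.mul_cexp_pow {m : ℕ} {f : E → ℝ} {B r : ℝ} (hf : ContDiff ℝ (⊤ : ℕ∞) f)
    (hr : 0 ≤ r) (hfB : DerivBound m f B r) (T : ℝ) (q : ℕ) :
    DerivBound m (fun x => (f x : ℂ) * Complex.exp (Complex.I * ((T * f x ^ (q + 1) : ℝ) : ℂ)))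
      (2 ^ m * B * m.factorial)
      ((1 + |T| * ((2 ^ m) ^ q * B ^ (q + 1))) * r) := by
  have hB := hfB.nonneg
  have hpow := DerivBound.const_mul (hf.pow (q + 1)) (hfB.pow_succ hf hr q) T
  have hfq : ContDiff ℝ (⊤ : ℕ∞) (fun x => T * f x ^ (q + 1)) :=
    contDiff_const.mul (hf.pow (q + 1))
  have hexp := hpow.cexp hfq hr
  have hr' : r ≤ (1 + |T| * ((2 ^ m) ^ q * B ^ (q + 1))) * r :=
    le_mul_of_one_le_left hr (le_add_of_nonneg_right (by positivity))
  have hsm : ContDiff ℝ (⊤ : ℕ∞)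
      (fun x => Complex.exp (Complex.I * ((T * f x ^ (q + 1) : ℝ) : ℂ))) :=
    (contDiff_const.mul (Complex.ofRealCLM.contDiff.comp hfq)).cexp
  simpa only [Complex.real_smul] using
    DerivBound.smul hf hsm (hr.trans hr') (hfB.mono le_rfl hr hr') hexp

theorem exists_derivBound_of_hasCompactSupport {f : E → F} (hf : ContDiff ℝ (⊤ : ℕ∞) f)
    (hs : HasCompactSupport f) (m : ℕ) : ∃ C, DerivBound m f C 1 := by
  have h (k : ℕ) : ∃ C, 0 ≤ C ∧ ∀ x, ‖iteratedFDeriv ℝ k f x‖ ≤ C := by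
    obtain ⟨C, hC⟩ := (hs.iteratedFDeriv (𝕜 := ℝ) k).exists_bound_of_continuous
      (hf.continuous_iteratedFDeriv (by exact_mod_cast le_top))
    exact ⟨C, (norm_nonneg _).trans (hC 0), hC⟩
  choose C hC0 hC using h
  refine ⟨∑ k ∈ Finset.range (m + 1), C k, fun k hk x => ?_⟩
  rw [one_pow, mul_one]
  exact (hC k x).trans (Finset.single_le_sum (fun i _ => hC0 i)
    (Finset.mem_range.mpr (Nat.lt_succ_of_le hk)))

end DerivBound

section PartialDerivatives

variable {F : Type} [NormedAddCommGroup F] [NormedSpace ℝ F]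

theorem contDiff_pd {f : E3 → F} (hf : ContDiff ℝ (⊤ : ℕ∞) f) (i : Fin 3) :
    ContDiff ℝ (⊤ : ℕ∞) (pd i f) :=
  (hf.fderiv_right (by simp)).clm_apply contDiff_const

theorem norm_iteratedFDeriv_pd_le {f : E3 → F} (hf : ContDiff ℝ (⊤ : ℕ∞) f) (i : Fin 3) (k : ℕ)
    (x : E3) : ‖iteratedFDeriv ℝ k (pd i f) x‖ ≤ ‖iteratedFDeriv ℝ (k + 1) f x‖ := by
  have hf' : ContDiff ℝ (⊤ : ℕ∞) (fderiv ℝ f) := hf.fderiv_right (by simp)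
  have h := norm_iteratedFDeriv_clm_apply_const (𝕜 := ℝ) (f := fderiv ℝ f)
    (c := EuclideanSpace.single i (1 : ℝ)) (x := x) (n := k) hf'.contDiffAt
    (by exact_mod_cast le_top)
  rw [norm_iteratedFDeriv_fderiv, PiLp.norm_single, norm_one, one_mul] at h
  exact h

theorem contDiff_iterate_pd {f : E3 → F} (hf : ContDiff ℝ (⊤ : ℕ∞) f) (i : Fin 3) (j : ℕ) :
    ContDiff ℝ (⊤ : ℕ∞) ((pd i)^[j] f) := by
  induction j with
  | zero => exact hf
  | succ j ih => rw [Function.iterate_succ_apply']; exact contDiff_pd ih i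

theorem norm_iteratedFDeriv_iterate_pd_le {f : E3 → F} (hf : ContDiff ℝ (⊤ : ℕ∞) f) (i : Fin 3)
    (j k : ℕ) (x : E3) :
    ‖iteratedFDeriv ℝ k ((pd i)^[j] f) x‖ ≤ ‖iteratedFDeriv ℝ (k + j) f x‖ := by
  induction j generalizing k with
  | zero => exact le_rfl
  | succ j ih =>
    rw [Function.iterate_succ_apply']
    refine (norm_iteratedFDeriv_pd_le (contDiff_iterate_pd hf i j) i k x).trans ?_
    have := ih (k + 1)
    rwa [show k + 1 + j = k + (j + 1) by ring] at this

theorem norm_pda_le {f : E3 → F} (hf : ContDiff ℝ (⊤ : ℕ∞) f) (α : Fin 3 → ℕ) (x : E3) :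
    ‖pda α f x‖ ≤ ‖iteratedFDeriv ℝ (α 0 + α 1 + α 2) f x‖ := by
  have h2 := contDiff_iterate_pd hf 2 (α 2)
  have h1 := contDiff_iterate_pd h2 1 (α 1)
  have h := norm_iteratedFDeriv_iterate_pd_le h1 0 (α 0) 0 x
  rw [norm_iteratedFDeriv_zero, zero_add] at h
  exact (h.trans (norm_iteratedFDeriv_iterate_pd_le h2 1 (α 1) (α 0) x)).trans
    (norm_iteratedFDeriv_iterate_pd_le hf 2 (α 2) _ x)

end PartialDerivatives

section Convolution

theorem norm_convolution_lsmul_le {E F : Type} [NormedAddCommGroup E] [MeasurableSpace E]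
    [NormedAddCommGroup F] [NormedSpace ℝ F]
    {μ : Measure E} {f : E → ℝ} {g : E → F} (hf : Integrable f μ) {C : ℝ} (hg : ∀ x, ‖g x‖ ≤ C)
    (x : E) :
    ‖convolution f g (ContinuousLinearMap.lsmul ℝ ℝ) μ x‖ ≤ (∫ y, ‖f y‖ ∂μ) * C := by
  rw [convolution_def, ← integral_mul_const]
  refine norm_integral_le_of_norm_le (hf.norm.mul_const C) (Filter.Eventually.of_forall fun y => ?_)
  simp only [ContinuousLinearMap.lsmul_apply, norm_smul]
  exact mul_le_mul_of_nonneg_left (hg _) (norm_nonneg _)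

/-- Derivatives of `f ∗ g` may be put on `g`, with `f` estimated in `L¹`. -/
theorem norm_iteratedFDeriv_convolution_lsmul_le {E F : Type} [NormedAddCommGroup E]
    [NormedSpace ℝ E] [MeasurableSpace E] [BorelSpace E] [NormedAddCommGroup F]
    [NormedSpace ℝ F] {μ : Measure E} [SFinite μ] [μ.IsAddLeftInvariant]
    {f : E → ℝ} {g : E → F} (hf : Integrable f μ)
    (hg : ContDiff ℝ (⊤ : ℕ∞) g) (hgs : HasCompactSupport g) {k : ℕ} {C : ℝ}
    (hC : ∀ x, ‖iteratedFDeriv ℝ k g x‖ ≤ C) (x : E) :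
    ‖iteratedFDeriv ℝ k (convolution f g (ContinuousLinearMap.lsmul ℝ ℝ) μ) x‖ ≤
      (∫ y, ‖f y‖ ∂μ) * C := by
  induction k generalizing F with
  | zero =>
    rw [norm_iteratedFDeriv_zero]
    exact norm_convolution_lsmul_le hf (by simpa using hC) x
  | succ k ih =>
    have hfd : fderiv ℝ (convolution f g (ContinuousLinearMap.lsmul ℝ ℝ) μ) =
        convolution f (fderiv ℝ g) (ContinuousLinearMap.lsmul ℝ ℝ) μ := by
      ext1 y
      rw [(hgs.hasFDerivAt_convolution_right (ContinuousLinearMap.lsmul ℝ ℝ)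
        hf.locallyIntegrable (hg.of_le (by exact_mod_cast le_top)) y).fderiv]
      rfl
    rw [← norm_iteratedFDeriv_fderiv, hfd]
    exact ih (hg.fderiv_right (by simp)) (hgs.fderiv ℝ)
      (fun y => by rw [norm_iteratedFDeriv_fderiv]; exact hC y)

theorem convR_comm (f g : E3 → ℝ) : convR f g = convR g f := by
  have h : (ContinuousLinearMap.lsmul ℝ ℝ : ℝ →L[ℝ] ℝ →L[ℝ] ℝ).flip =
      ContinuousLinearMap.lsmul ℝ ℝ := by
    ext; simp
  rw [convR, convR, ← convolution_flip, h]

end Convolution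

section Dilation

variable {g : E3 → ℝ} {a : ℝ}

theorem contDiff_dilation (hg : ContDiff ℝ (⊤ : ℕ∞) g) (c a : ℝ) :
    ContDiff ℝ (⊤ : ℕ∞) (fun x => c * g (a • x)) :=
  contDiff_const.mul (hg.comp (contDiff_const_smul a))

theorem hasCompactSupport_dilation (hgs : HasCompactSupport g) (c : ℝ) (ha : 0 < a) :
    HasCompactSupport (fun x => c * g (a • x)) :=
  (hgs.comp_smul ha.ne').mul_left

theorem integrable_dilation (hg : ContDiff ℝ (⊤ : ℕ∞) g) (hgs : HasCompactSupport g) (c : ℝ)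
    (ha : 0 < a) : Integrable (fun x => c * g (a • x)) :=
  (contDiff_dilation hg c a).continuous.integrable_of_hasCompactSupport
    (hasCompactSupport_dilation hgs c ha)

theorem integral_norm_dilation (g : E3 → ℝ) (c : ℝ) (ha : 0 < a) :
    ∫ x, ‖c * g (a • x)‖ = |c| * (a ^ 3)⁻¹ * ∫ x, ‖g x‖ := by
  simp only [norm_mul, Real.norm_eq_abs]
  rw [integral_const_mul, Measure.integral_comp_smul volume (fun x => |g x|) a]
  simp only [finrank_euclideanSpace, Fintype.card_fin, smul_eq_mul]
  rw [abs_of_pos (by positivity : 0 < (a ^ 3)⁻¹)]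
  ring

theorem DerivBound.dilation {m : ℕ} {C : ℝ} (hg : ContDiff ℝ (⊤ : ℕ∞) g)
    (hC : DerivBound m g C 1) (c : ℝ) (ha : 0 < a) :
    DerivBound m (fun x => c * g (a • x)) (|c| * C) a :=
  (hC.comp_const_smul hg ha.le).const_mul (hg.comp (contDiff_const_smul a)) c

end Dilation

theorem kap_nonneg (γ : ℝ) {n : ℝ} (hn : 2 ≤ n) : 0 ≤ kap γ n :=
  Real.rpow_nonneg (Real.log_nonneg (by linarith)) _

theorem lam_sq (q : ℕ) (s γ : ℝ) {n : ℝ} (hn : 2 ≤ n) :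
    lam (q + 1) s γ n ^ 2 = (kap γ n * n ^ ((3 : ℝ) / 2 - s)) ^ q := by
  have hn0 : (0 : ℝ) ≤ n := by linarith
  have hk := kap_nonneg γ hn
  rw [lam, mul_pow, mul_pow, ← Real.rpow_mul_natCast hk, ← Real.rpow_mul_natCast hn0,
    ← Real.rpow_mul_natCast hn0, ← Real.rpow_natCast (kap γ n) q]
  congr 2 <;> push_cast <;> ring

theorem contDiff_bubbleE (s γ : ℝ) {ρ φ : E3 → ℝ} (hρ : ContDiff ℝ (⊤ : ℕ∞) ρ)
    (hρs : HasCompactSupport ρ) (hφ : ContDiff ℝ (⊤ : ℕ∞) φ) (hφs : HasCompactSupport φ)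
    {n ε : ℝ} (hn : 0 < n) (hε : 0 < ε) :
    ContDiff ℝ (⊤ : ℕ∞) (bubbleE s γ ρ φ n ε) :=
  (hasCompactSupport_dilation hφs _ hn).contDiff_convolution_right _
    (integrable_dilation hρ hρs _ (inv_pos.mpr hε)).locallyIntegrable (contDiff_dilation hφ _ n)

/-- The regularized bubble has amplitude `κ_n n^{3/2-s} μ³` and frequency `nμ`, where
`μ = min(1, 1/(εn))`. -/
theorem exists_derivBound_bubbleE (s γ : ℝ) {ρ φ : E3 → ℝ} (hρ : ContDiff ℝ (⊤ : ℕ∞) ρ)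
    (hρs : HasCompactSupport ρ) (hρ1 : ∫ x, ‖ρ x‖ = 1) (hφ : ContDiff ℝ (⊤ : ℕ∞) φ)
    (hφs : HasCompactSupport φ) (m : ℕ) :
    ∃ K > 0, ∀ n : ℝ, 2 ≤ n → ∀ ε : ℝ, 0 < ε →
      DerivBound m (bubbleE s γ ρ φ n ε)
        (K * (kap γ n * n ^ ((3 : ℝ) / 2 - s) * min 1 (1 / (ε * n)) ^ 3))
        (n * min 1 (1 / (ε * n))) := by
  obtain ⟨Cφ, hCφ⟩ := exists_derivBound_of_hasCompactSupport hφ hφs m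
  obtain ⟨Cρ, hCρ⟩ := exists_derivBound_of_hasCompactSupport hρ hρs m
  have hCφ0 := hCφ.nonneg
  have hCρ0 := hCρ.nonneg
  have hI : 0 ≤ ∫ x, ‖φ x‖ := integral_nonneg fun x => norm_nonneg _
  refine ⟨Cφ + Cρ * (∫ x, ‖φ x‖) + 1, by positivity, fun n hn ε hε => ?_⟩
  have hn0 : 0 < n := by linarith
  have hA : 0 ≤ kap γ n * n ^ ((3 : ℝ) / 2 - s) :=
    mul_nonneg (kap_nonneg γ hn) (Real.rpow_nonneg hn0.le _)
  have hεi : 0 < ε⁻¹ := inv_pos.mpr hε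
  rcases le_total (ε * n) 1 with hle | hle
  · rw [min_eq_left ((one_le_div (by positivity)).mpr hle), one_pow, mul_one, mul_one]
    have h : DerivBound m (bubbleE s γ ρ φ n ε) (Cφ * (kap γ n * n ^ ((3 : ℝ) / 2 - s))) n := by
      intro k hk x
      have hb := norm_iteratedFDeriv_convolution_lsmul_le
        (integrable_dilation hρ hρs (ε ^ 3)⁻¹ hεi)
        (contDiff_dilation hφ (kap γ n * n ^ ((3 : ℝ) / 2 - s)) n)
        (hasCompactSupport_dilation hφs _ hn0)
        (hCφ.dilation hφ (kap γ n * n ^ ((3 : ℝ) / 2 - s)) hn0 k hk) x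
      refine hb.trans_eq ?_
      rw [integral_norm_dilation ρ _ hεi, hρ1, abs_of_nonneg hA,
        abs_of_pos (by positivity : 0 < (ε ^ 3)⁻¹)]
      field_simp
    exact h.mono (mul_le_mul_of_nonneg_right (by nlinarith [mul_nonneg hCρ0 hI]) hA) hn0.le le_rfl
  · rw [min_eq_right ((div_le_one (by positivity)).mpr hle)]
    have h : DerivBound m (bubbleE s γ ρ φ n ε)
        (Cρ * (∫ x, ‖φ x‖) * (kap γ n * n ^ ((3 : ℝ) / 2 - s) * (1 / (ε * n)) ^ 3))
        (n * (1 / (ε * n))) := by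
      intro k hk x
      have hb := norm_iteratedFDeriv_convolution_lsmul_le
        (integrable_dilation hφ hφs (kap γ n * n ^ ((3 : ℝ) / 2 - s)) hn0)
        (contDiff_dilation hρ (ε ^ 3)⁻¹ ε⁻¹)
        (hasCompactSupport_dilation hρs _ hεi)
        (hCρ.dilation hρ (ε ^ 3)⁻¹ hεi k hk) x
      rw [bubbleE, convR_comm]
      refine hb.trans_eq ?_
      rw [integral_norm_dilation φ _ hn0, abs_of_nonneg hA,
        abs_of_pos (by positivity : 0 < (ε ^ 3)⁻¹), show n * (1 / (ε * n)) = ε⁻¹ by field_simp]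
      field_simp
    exact h.mono (mul_le_mul_of_nonneg_right (by linarith) (by positivity)) (by positivity) le_rfl

theorem vE_eq {q : ℕ} (hq : Even (q + 1)) (σ s γ : ℝ) (ρ φ : E3 → ℝ) (n ε t : ℝ) :
    vE σ (q + 2) s γ ρ φ n ε t = fun x => (bubbleE s γ ρ φ n ε x : ℂ) *
      Complex.exp (Complex.I * ((σ * t * bubbleE s γ ρ φ n ε x ^ (q + 1) : ℝ) : ℂ)) := by
  ext x
  have h : ((q + 2 : ℕ) : ℝ) - 1 = ((q + 1 : ℕ) : ℝ) := by push_cast; ring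
  rw [vE, h, Real.rpow_natCast, hq.pow_abs]
  push_cast
  ring_nf

/-- The scalar inequality turning `DerivBound.mul_cexp_pow` into the final estimate. -/
theorem profile_bound_le {K A μ n T : ℝ} (hK : 0 < K) (hA : 0 ≤ A) (hμ : 0 ≤ μ) (hμ1 : μ ≤ 1)
    (hn : 0 ≤ n) (hT : 0 ≤ T) (m q : ℕ) :
    2 ^ m * (K * (A * μ ^ 3)) * m.factorial *
        ((1 + T * ((2 ^ m) ^ q * (K * (A * μ ^ 3)) ^ (q + 1))) * (n * μ)) ^ m ≤
      2 ^ m * K * m.factorial * (1 + (2 ^ m) ^ q * K ^ (q + 1)) ^ m * 2 ^ m *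
        (A * n ^ m * (1 + (T * A ^ (q + 1)) ^ m) * (μ ^ m * μ ^ 3)) := by
  set L : ℝ := (2 ^ m) ^ q * K ^ (q + 1) with hL
  have hL0 : 0 ≤ L := by positivity
  have h1 : T * ((2 ^ m) ^ q * (K * (A * μ ^ 3)) ^ (q + 1)) ≤ L * (T * A ^ (q + 1)) := by
    have : (K * (A * μ ^ 3)) ^ (q + 1) ≤ (K * (A * 1)) ^ (q + 1) := by
      gcongr
      exact pow_le_one₀ hμ hμ1
    calc _ ≤ T * ((2 ^ m) ^ q * (K * (A * 1)) ^ (q + 1)) := by gcongr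
      _ = L * (T * A ^ (q + 1)) := by rw [hL]; ring
  set τ : ℝ := T * A ^ (q + 1) with hτ
  have hτ0 : 0 ≤ τ := by positivity
  have h2 : (1 + τ) ^ m ≤ 2 ^ m * (1 + τ ^ m) := by
    refine (add_pow_le zero_le_one hτ0 m).trans ?_
    rw [one_pow]
    gcongr
    · exact one_le_two
    · omega
  have h3 : 1 + T * ((2 ^ m) ^ q * (K * (A * μ ^ 3)) ^ (q + 1)) ≤ (1 + L) * (1 + τ) := by
    linarith
  calc _ ≤ 2 ^ m * (K * (A * μ ^ 3)) * m.factorial * (((1 + L) * (1 + τ)) * (n * μ)) ^ m := by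
        gcongr
    _ = 2 ^ m * K * m.factorial * (1 + L) ^ m * (A * n ^ m * (1 + τ) ^ m * (μ ^ m * μ ^ 3)) := by
        simp only [mul_pow]; ring
    _ ≤ 2 ^ m * K * m.factorial * (1 + L) ^ m *
          (A * n ^ m * (2 ^ m * (1 + τ ^ m)) * (μ ^ m * μ ^ 3)) := by
        gcongr
    _ = _ := by ring

/-- `L^∞` bounds on the derivatives of the regularized ODE profile:
for every `m` there is `C > 0` such that for all `n ≥ 2`, `t ∈ ℝ`, `ε > 0` and every
multi-index `α` with `|α| = m`,
`‖∂^α v_nᵉ(t)‖_{L^∞} ≤ C κ_n n^{m+3/2-s} (1 + (|t| λ_n²)^m) min(1, 1/(εn))^{m+3/2}`. -/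
theorem stmt1
    (σ : ℝ) (hσ : σ = 1 ∨ σ = -1)
    (p : ℕ) (hp_odd : Odd p) (hp : 3 ≤ p)
    (s : ℝ) (hs0 : 0 < s) (hs32 : s < 3 / 2)
    (γ : ℝ) (hγ0 : 0 < γ) (hγ1 : γ < 1)
    (ρ : E3 → ℝ) (hρ_smooth : ContDiff ℝ (⊤ : ℕ∞) ρ) (hρ_supp : HasCompactSupport ρ)
    (hρ_nonneg : ∀ x, 0 ≤ ρ x) (hρ_le : ∀ x, ρ x ≤ 1) (hρ_int : ∫ x, ρ x = 1)
    (φ : E3 → ℝ) (hφ_smooth : ContDiff ℝ (⊤ : ℕ∞) φ)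
    (hφ_supp : tsupport φ ⊆ Metric.closedBall 0 1)
    (hφ_nonneg : ∀ x, 0 ≤ φ x) (hφ_le : ∀ x, φ x ≤ 1)
    (m : ℕ) :
    ∃ C > 0, ∀ n : ℝ, 2 ≤ n → ∀ t : ℝ, ∀ ε : ℝ, 0 < ε →
      ∀ α : Fin 3 → ℕ, α 0 + α 1 + α 2 = m →
      eLpNorm (pda α (vE σ p s γ ρ φ n ε t)) ⊤ volume ≤
        ENNReal.ofReal (C * kap γ n * n ^ ((m : ℝ) + 3 / 2 - s) *
          (1 + (|t| * lam p s γ n ^ 2) ^ m) *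
          (min 1 (1 / (ε * n))) ^ ((m : ℝ) + 3 / 2)) := by
  have hφ_cpt : HasCompactSupport φ :=
    (isCompact_closedBall 0 1).of_isClosed_subset (isClosed_tsupport φ) hφ_supp
  have hρ1 : ∫ x, ‖ρ x‖ = 1 := by
    simpa only [Real.norm_of_nonneg (hρ_nonneg _)] using hρ_int
  obtain ⟨K, hK, hbd⟩ :=
    exists_derivBound_bubbleE s γ hρ_smooth hρ_supp hρ1 hφ_smooth hφ_cpt m
  obtain ⟨q, rfl⟩ : ∃ q, p = q + 2 := ⟨p - 2, by omega⟩
  have hq : Even (q + 1) := by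
    rcases hp_odd with ⟨j, hj⟩
    exact ⟨j, by omega⟩
  refine ⟨2 ^ m * K * m.factorial * (1 + (2 ^ m) ^ q * K ^ (q + 1)) ^ m * 2 ^ m, by positivity,
    fun n hn t ε hε α hα => ?_⟩
  have hn0 : 0 < n := by linarith
  have hσt : |σ * t| = |t| := by rcases hσ with rfl | rfl <;> simp
  have hμ : 0 < min 1 (1 / (ε * n)) := lt_min one_pos (by positivity)
  have hμ1 : min 1 (1 / (ε * n)) ≤ 1 := min_le_left _ _
  have hw := contDiff_bubbleE s γ hρ_smooth hρ_supp hφ_smooth hφ_cpt hn0 hε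
  have hv := (hbd n hn ε hε).mul_cexp_pow hw (by positivity) (σ * t) q
  have hA : 0 ≤ kap γ n * n ^ ((3 : ℝ) / 2 - s) :=
    mul_nonneg (kap_nonneg γ hn) (Real.rpow_nonneg hn0.le _)
  have hsm : ContDiff ℝ (⊤ : ℕ∞) (vE σ (q + 2) s γ ρ φ n ε t) := by
    rw [vE_eq hq]
    exact (Complex.ofRealCLM.contDiff.comp hw).mul (contDiff_const.mul
      (Complex.ofRealCLM.contDiff.comp (contDiff_const.mul (hw.pow (q + 1))))).cexp
  rw [eLpNorm_exponent_top]
  refine eLpNormEssSup_le_of_ae_bound (Filter.Eventually.of_forall fun x => ?_)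
  refine (norm_pda_le hsm α x).trans ?_
  rw [hα, vE_eq hq]
  refine (hv m le_rfl x).trans ?_
  rw [hσt]
  refine (profile_bound_le hK hA hμ.le hμ1 hn0.le (abs_nonneg t) m q).trans ?_
  have hnpow : n ^ ((m : ℝ) + 3 / 2 - s) = n ^ m * n ^ ((3 : ℝ) / 2 - s) := by
    rw [add_sub_assoc, Real.rpow_add hn0, Real.rpow_natCast]
  have hμpow : min 1 (1 / (ε * n)) ^ m * min 1 (1 / (ε * n)) ^ 3 ≤
      min 1 (1 / (ε * n)) ^ ((m : ℝ) + 3 / 2) := by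
    rw [← pow_add, ← Real.rpow_natCast]
    refine Real.rpow_le_rpow_of_exponent_ge hμ hμ1 ?_
    push_cast
    linarith
  rw [lam_sq (q + 1) s γ hn, hnpow]
  refine (mul_le_mul_of_nonneg_left (mul_le_mul_of_nonneg_left hμpow ?_) ?_).trans_eq ?_
  · positivity
  · positivity
  · ring
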